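/- Let f : ℝⁿ → ℝⁿ be continuous and consider ẋ = f(x), where a solution is a differentiable function φ : [0, T) → ℝⁿ (0 < T ≤ ∞) with φ′(t) = f(φ(t)) for all t ∈ [0, T), complete if T = ∞. Suppose: (i) Mₑ ⊆ ℝⁿ is closed and forward invariant (every solution with φ(0) ∈ Mₑ satisfies φ(t) ∈ Mₑ for all t in its domain); (ii) Mᵢ ⊆ Mₑ is closed, stable relative to Mₑ, and globally attractive relative to Mₑ; (iii) M∘ ⊆ Mᵢ is compact, stable relative to Mᵢ, and globally attractive relative to Mᵢ. Then M∘ is asymptotically stable relative to Mₑ: M∘ is stable relative to Mₑ, and there exists δ > 0 such that every complete solution φ with φ(0) ∈ Mₑ and dist(φ(0), M∘) < δ satisfies dist(φ(t), M∘) → 0 as t → ∞. -/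

import Mathlib

open Metric Filter Topology

/-- `φ : ℝ → ℝⁿ` restricted to `[0, T)` (with `0 < T ≤ ∞`) is a solution of `ẋ = f x`. -/
def IsSolution {d : ℕ} (f : EuclideanSpace ℝ (Fin d) → EuclideanSpace ℝ (Fin d))
    (T : EReal) (φ : ℝ → EuclideanSpace ℝ (Fin d)) : Prop :=
  0 < T ∧ ∀ t : ℝ, 0 ≤ t → (t : EReal) < T →
    HasDerivWithinAt φ (f (φ t)) {s : ℝ | 0 ≤ s ∧ (s : EReal) < T} t

/-- `Y` is forward invariant for `ẋ = f x`. -/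
def FwdInvariant {d : ℕ} (f : EuclideanSpace ℝ (Fin d) → EuclideanSpace ℝ (Fin d))
    (Y : Set (EuclideanSpace ℝ (Fin d))) : Prop :=
  ∀ (T : EReal) (φ : ℝ → EuclideanSpace ℝ (Fin d)), IsSolution f T φ → φ 0 ∈ Y →
    ∀ t : ℝ, 0 ≤ t → (t : EReal) < T → φ t ∈ Y

/-- `X` is stable relative to `Y` for `ẋ = f x`. -/
def StableRelCT {d : ℕ} (f : EuclideanSpace ℝ (Fin d) → EuclideanSpace ℝ (Fin d))
    (Y X : Set (EuclideanSpace ℝ (Fin d))) : Prop :=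
  ∀ ε > (0 : ℝ), ∀ Δ > (0 : ℝ), ∃ δ > (0 : ℝ),
    ∀ (T : EReal) (φ : ℝ → EuclideanSpace ℝ (Fin d)), IsSolution f T φ → φ 0 ∈ Y →
      infDist (φ 0) X < δ → ‖φ 0‖ < Δ →
        ∀ t : ℝ, 0 ≤ t → (t : EReal) < T → infDist (φ t) X < ε

/-- `X` is globally attractive relative to `Y` for `ẋ = f x`. -/
def GloballyAttractiveRelCT {d : ℕ}
    (f : EuclideanSpace ℝ (Fin d) → EuclideanSpace ℝ (Fin d))
    (Y X : Set (EuclideanSpace ℝ (Fin d))) : Prop :=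
  ∀ φ : ℝ → EuclideanSpace ℝ (Fin d), IsSolution f ⊤ φ → φ 0 ∈ Y →
    Tendsto (fun t : ℝ => infDist (φ t) X) atTop (𝓝 0)

section Helpers

variable {d : ℕ}

/-- Mean value inequality on `[0,a]` for solutions staying in a set where `‖f‖ ≤ C`. -/
lemma sol_lipschitz {f : EuclideanSpace ℝ (Fin d) → EuclideanSpace ℝ (Fin d)}
    {K : Set (EuclideanSpace ℝ (Fin d))} {C : ℝ} (hC : ∀ x ∈ K, ‖f x‖ ≤ C)
    {g : ℝ → EuclideanSpace ℝ (Fin d)} {a : ℝ}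
    (hg : ∀ t ∈ Set.Icc 0 a, HasDerivWithinAt g (f (g t)) (Set.Icc 0 a) t)
    (hK : ∀ t ∈ Set.Icc 0 a, g t ∈ K) {s t : ℝ} (hs : s ∈ Set.Icc 0 a) (ht : t ∈ Set.Icc 0 a) :
    ‖g t - g s‖ ≤ C * |t - s| := by
  have := Convex.norm_image_sub_le_of_norm_hasDerivWithin_le (C := C) hg
    (fun x hx => hC _ (hK x hx)) (convex_Icc 0 a) hs ht
  simpa [Real.norm_eq_abs] using this

lemma limit_solution {f : EuclideanSpace ℝ (Fin d) → EuclideanSpace ℝ (Fin d)}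
    (hf : Continuous f) {K : Set (EuclideanSpace ℝ (Fin d))} (hKc : IsCompact K)
    (U : Ultrafilter ℕ) (g : ℕ → ℝ → EuclideanSpace ℝ (Fin d)) (a : ℕ → ℝ)
    (hg : ∀ n, ∀ t ∈ Set.Icc 0 (a n),
      HasDerivWithinAt (g n) (f (g n t)) (Set.Icc 0 (a n)) t)
    (hK : ∀ n, ∀ t ∈ Set.Icc 0 (a n), g n t ∈ K)
    {T : EReal} (hT : 0 < T) (hTa : ∀ t : ℝ, (t : EReal) < T → ∀ᶠ n in (U : Filter ℕ), t < a n) :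
    ∃ ψ : ℝ → EuclideanSpace ℝ (Fin d), IsSolution f T ψ ∧
      ∀ t : ℝ, 0 ≤ t → (t : EReal) < T →
        Tendsto (fun n => g n t) (U : Filter ℕ) (𝓝 (ψ t)) := by
  have hex : ∀ t : ℝ, ∃ x, 0 ≤ t → (t : EReal) < T →
      Tendsto (fun n => g n t) (U : Filter ℕ) (𝓝 x) := by
    intro t
    by_cases h : 0 ≤ t ∧ (t : EReal) < T
    · have hmem : K ∈ U.map (fun n => g n t) := by
        have : ∀ᶠ n in (U : Filter ℕ), g n t ∈ K := by
          filter_upwards [hTa t h.2] with n hn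
          exact hK n t ⟨h.1, hn.le⟩
        exact this
      obtain ⟨x, -, hx⟩ := hKc.ultrafilter_le_nhds' _ hmem
      exact ⟨x, fun _ _ => hx⟩
    · exact ⟨0, fun h1 h2 => absurd ⟨h1, h2⟩ h⟩
  choose ψ hψ using hex
  refine ⟨ψ, ⟨hT, ?_⟩, hψ⟩
  intro t ht0 htT
  obtain ⟨C0, hC0⟩ := hKc.exists_bound_of_continuousOn hf.continuousOn
  set C := |C0| + 1 with hCdef
  have hCpos : 0 < C := by positivity
  have hC : ∀ x ∈ K, ‖f x‖ ≤ C := fun x hx => (hC0 x hx).trans (by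
    have := le_abs_self C0; linarith)
  rw [hasDerivWithinAt_iff_isLittleO, Asymptotics.isLittleO_iff]
  intro η hη
  obtain ⟨r, hr, hfr⟩ := Metric.continuousAt_iff.1 (hf.continuousAt (x := ψ t)) η hη
  have hev : ∀ᶠ s in 𝓝[{s : ℝ | 0 ≤ s ∧ (s : EReal) < T}] t, dist s t < r / (2 * C) :=
    nhdsWithin_le_nhds (Metric.ball_mem_nhds t (by positivity))
  filter_upwards [hev, self_mem_nhdsWithin] with s hs hsS
  obtain ⟨hs0, hsT⟩ := hsS
  have hlim : Tendsto (fun n => ‖g n s - g n t - (s - t) • f (ψ t)‖) (U : Filter ℕ)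
      (𝓝 ‖ψ s - ψ t - (s - t) • f (ψ t)‖) :=
    (((hψ s hs0 hsT).sub (hψ t ht0 htT)).sub tendsto_const_nhds).norm
  refine le_of_tendsto hlim ?_
  have hclose : ∀ᶠ n in (U : Filter ℕ), dist (g n t) (ψ t) < r / 2 :=
    (hψ t ht0 htT) (Metric.ball_mem_nhds _ (by positivity))
  filter_upwards [hTa t htT, hTa s hsT, hclose] with n hnt hns hnc
  have hsub : Set.uIcc t s ⊆ Set.Icc 0 (a n) :=
    Set.uIcc_subset_Icc ⟨ht0, hnt.le⟩ ⟨hs0, hns.le⟩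
  have hder : ∀ u ∈ Set.uIcc t s,
      HasDerivWithinAt (fun u => g n u - u • f (ψ t)) (f (g n u) - (1:ℝ) • f (ψ t))
        (Set.uIcc t s) u := by
    intro u hu
    exact ((hg n u (hsub hu)).mono hsub).sub ((hasDerivWithinAt_id u _).smul_const _)
  have hbd : ∀ u ∈ Set.uIcc t s, ‖f (g n u) - (1:ℝ) • f (ψ t)‖ ≤ η := by
    intro u hu
    rw [one_smul, ← dist_eq_norm]
    refine (hfr ?_).le
    have h1 := sol_lipschitz hC (hg n) (hK n) (hsub Set.left_mem_uIcc) (hsub hu)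
    have h2 : |u - t| ≤ |s - t| := Set.abs_sub_left_of_mem_uIcc hu
    have h3 : |s - t| < r / (2 * C) := by simpa [Real.dist_eq] using hs
    have h4 : C * |u - t| < r / 2 := by
      calc C * |u - t| ≤ C * |s - t| := by gcongr
        _ < C * (r / (2 * C)) := by gcongr
        _ = r / 2 := by field_simp
    calc dist (g n u) (ψ t) ≤ dist (g n u) (g n t) + dist (g n t) (ψ t) := dist_triangle _ _ _
      _ < r / 2 + r / 2 := by
        rw [dist_eq_norm (g n u)]; linarith
      _ = r := by ring
  have := Convex.norm_image_sub_le_of_norm_hasDerivWithin_le hder hbd (convex_uIcc t s)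
    Set.left_mem_uIcc Set.right_mem_uIcc
  have heq : g n s - g n t - (s - t) • f (ψ t)
      = g n s - s • f (ψ t) - (g n t - t • f (ψ t)) := by
    rw [sub_smul]; abel
  rw [heq]
  exact this

lemma shift_deriv {f : EuclideanSpace ℝ (Fin d) → EuclideanSpace ℝ (Fin d)} {T : EReal}
    {φ : ℝ → EuclideanSpace ℝ (Fin d)} (hφ : IsSolution f T φ) {s : ℝ} (hs : 0 ≤ s)
    {S : Set ℝ} (hS : ∀ u ∈ S, 0 ≤ u ∧ ((s + u : ℝ) : EReal) < T) :
    ∀ t ∈ S, HasDerivWithinAt (fun u => φ (s + u)) (f (φ (s + t))) S t := by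
  intro t ht
  have h1 := hφ.2 (s + t) (by linarith [(hS t ht).1]) (hS t ht).2
  have h2 : HasDerivWithinAt (fun u : ℝ => s + u) 1 S t :=
    (hasDerivWithinAt_id t S).const_add s
  have h3 := HasDerivWithinAt.scomp t h1 h2
    (fun u hu => ⟨by linarith [(hS u hu).1], (hS u hu).2⟩)
  rw [one_smul] at h3
  exact h3

lemma shift_complete {f : EuclideanSpace ℝ (Fin d) → EuclideanSpace ℝ (Fin d)}
    {φ : ℝ → EuclideanSpace ℝ (Fin d)} (hφ : IsSolution f ⊤ φ) {s : ℝ} (hs : 0 ≤ s) :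
    IsSolution f ⊤ (fun u => φ (s + u)) :=
  ⟨hφ.1, fun t ht htT => shift_deriv hφ hs
    (S := {u : ℝ | 0 ≤ u ∧ (u : EReal) < ⊤}) (fun u hu => ⟨hu.1, EReal.coe_lt_top _⟩) t ⟨ht, htT⟩⟩

lemma crossing {h : ℝ → ℝ} {t δ ε : ℝ} (ht : 0 ≤ t) (hc : ContinuousOn h (Set.Icc 0 t))
    (h0 : h 0 < δ) (hδε : δ < ε) (h1 : ε ≤ h t) :
    ∃ s r, 0 ≤ s ∧ s ≤ r ∧ r ≤ t ∧ h s = δ ∧ h r = ε ∧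
      ∀ u ∈ Set.Icc s r, δ ≤ h u ∧ h u ≤ ε := by
  have hcomp : IsCompact (Set.Icc 0 t ∩ h ⁻¹' Set.Ici ε) :=
    isCompact_Icc.of_isClosed_subset (hc.preimage_isClosed_of_isClosed isClosed_Icc isClosed_Ici)
      Set.inter_subset_left
  obtain ⟨r, ⟨⟨hr0, hrt⟩, hrε⟩, hrl⟩ := hcomp.exists_isLeast ⟨t, ⟨ht, le_rfl⟩, h1⟩
  have hcr : ContinuousOn h (Set.Icc 0 r) := hc.mono (Set.Icc_subset_Icc_right hrt)
  have hr : h r = ε := by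
    obtain ⟨u, hu, hue⟩ := intermediate_value_Icc hr0 hcr (show ε ∈ Set.Icc (h 0) (h r) from
      ⟨by linarith, hrε⟩)
    have : r ≤ u := hrl ⟨⟨hu.1, hu.2.trans hrt⟩, hue.ge⟩
    rwa [le_antisymm hu.2 this] at hue
  have hcomp2 : IsCompact (Set.Icc 0 r ∩ h ⁻¹' Set.Iic δ) :=
    isCompact_Icc.of_isClosed_subset (hcr.preimage_isClosed_of_isClosed isClosed_Icc isClosed_Iic)
      Set.inter_subset_left
  obtain ⟨s, ⟨⟨hs0, hsr⟩, hsδ⟩, hsg⟩ := hcomp2.exists_isGreatest ⟨0, ⟨le_rfl, hr0⟩, h0.le⟩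
  have hs : h s = δ := by
    obtain ⟨u, hu, hue⟩ := intermediate_value_Icc hsr (hcr.mono (Set.Icc_subset_Icc_left hs0))
      (show δ ∈ Set.Icc (h s) (h r) from ⟨hsδ, by linarith⟩)
    have : u ≤ s := hsg ⟨⟨hs0.trans hu.1, hu.2⟩, hue.le⟩
    rwa [le_antisymm this hu.1] at hue
  refine ⟨s, r, hs0, hsr, hrt, hs, hr, fun u hu => ⟨?_, ?_⟩⟩
  · by_contra! hlt
    have : u ≤ s := hsg ⟨⟨hs0.trans hu.1, hu.2⟩, hlt.le⟩
    rw [le_antisymm this hu.1, hs] at hlt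
    exact lt_irrefl _ hlt
  · by_contra! hlt
    have : r ≤ u := hrl ⟨⟨hs0.trans hu.1, hu.2.trans hrt⟩, hlt.le⟩
    rw [le_antisymm hu.2 this, hr] at hlt
    exact lt_irrefl _ hlt

lemma tendsto_infDist {l : Filter ℕ} {u : ℕ → EuclideanSpace ℝ (Fin d)}
    {x : EuclideanSpace ℝ (Fin d)} (X : Set (EuclideanSpace ℝ (Fin d)))
    (h : Tendsto u l (𝓝 x)) : Tendsto (fun n => infDist (u n) X) l (𝓝 (infDist x X)) :=
  ((continuous_infDist_pt X).tendsto x).comp h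

lemma sublevel_compact {Mo : Set (EuclideanSpace ℝ (Fin d))} (hMo : IsCompact Mo)
    (hne : Mo.Nonempty) (ε : ℝ) : IsCompact {x | infDist x Mo ≤ ε} := by
  refine isCompact_of_isClosed_isBounded
    (isClosed_le (continuous_infDist_pt Mo) continuous_const)
    ((hMo.isBounded.thickening (δ := ε + 1)).subset ?_)
  intro x hx
  rw [mem_thickening_iff_infDist_lt hne]
  exact lt_of_le_of_lt hx (by linarith)

theorem stable_part (f : EuclideanSpace ℝ (Fin d) → EuclideanSpace ℝ (Fin d)) (hf : Continuous f)
    (Me Mi Mo : Set (EuclideanSpace ℝ (Fin d)))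
    (hMiClosed : IsClosed Mi) (hMiStable : StableRelCT f Me Mi)
    (hMoSub : Mo ⊆ Mi) (hMoCompact : IsCompact Mo) (hne : Mo.Nonempty)
    (hMoStable : StableRelCT f Mi Mo) (hMoAttr : GloballyAttractiveRelCT f Mi Mo)
    (ε : ℝ) (hε : 0 < ε) :
    ∃ δ > (0 : ℝ), ∀ (T : EReal) (φ : ℝ → EuclideanSpace ℝ (Fin d)), IsSolution f T φ →
      φ 0 ∈ Me → infDist (φ 0) Mo < δ → ∀ t : ℝ, 0 ≤ t → (t : EReal) < T →
        infDist (φ t) Mo < ε := by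
  by_contra! hcon
  set K := {x : EuclideanSpace ℝ (Fin d) | infDist x Mo ≤ ε} with hKdef
  have hKc : IsCompact K := sublevel_compact hMoCompact hne ε
  obtain ⟨R0, hR0⟩ := hKc.isBounded.exists_norm_le
  set R := |R0| + 1
  have hRpos : 0 < R := by positivity
  have hR : ∀ x ∈ K, ‖x‖ < R := fun x hx => by
    have := hR0 x hx; have := le_abs_self R0; simp only [R]; linarith
  obtain ⟨C0, hC0⟩ := hKc.exists_bound_of_continuousOn hf.continuousOn
  set C := |C0| + 1 with hCdef
  have hCpos : 0 < C := by positivity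
  have hC : ∀ x ∈ K, ‖f x‖ ≤ C := fun x hx => (hC0 x hx).trans (by
    have := le_abs_self C0; linarith)
  obtain ⟨δ0, hδ0, hstab⟩ := hMoStable (ε / 2) (by positivity) R hRpos
  set δ := min δ0 ε / 2 with hδdef
  have hmin : 0 < min δ0 ε := lt_min hδ0 hε
  have hδ : 0 < δ := by positivity
  have hδ1 : δ < δ0 := by have := min_le_left δ0 ε; linarith
  have hδ2 : δ ≤ ε / 2 := by have := min_le_right δ0 ε; linarith
  have key : ∀ n : ℕ, ∃ (g : ℝ → EuclideanSpace ℝ (Fin d)) (a : ℝ), 0 ≤ a ∧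
      (∀ t ∈ Set.Icc 0 a, HasDerivWithinAt g (f (g t)) (Set.Icc 0 a) t) ∧
      infDist (g 0) Mo = δ ∧ infDist (g a) Mo = ε ∧
      (∀ t ∈ Set.Icc 0 a, δ ≤ infDist (g t) Mo ∧ infDist (g t) Mo ≤ ε ∧
        infDist (g t) Mi ≤ 1 / ((n : ℝ) + 1)) := by
    intro n
    obtain ⟨δn, hδn, hn⟩ := hMiStable (1 / ((n : ℝ) + 1)) (by positivity) R hRpos
    obtain ⟨T, φ, hφ, hφ0, hφδ, t, ht0, htT, hbad⟩ := hcon (min δn δ) (lt_min hδn hδ)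
    have hI : ∀ u ∈ Set.Icc 0 t, 0 ≤ u ∧ (u : EReal) < T := fun u hu =>
      ⟨hu.1, lt_of_le_of_lt (EReal.coe_le_coe_iff.2 hu.2) htT⟩
    have hcont : ContinuousOn (fun u => infDist (φ u) Mo) (Set.Icc 0 t) := by
      refine (continuous_infDist_pt Mo).comp_continuousOn ?_
      intro u hu
      exact ((hφ.2 u (hI u hu).1 (hI u hu).2).continuousWithinAt).mono hI
    obtain ⟨s, r, hs0, hsr, hrt, hs, hr, hin⟩ := crossing ht0 hcont
      (lt_of_lt_of_le hφδ (min_le_right _ _)) (by linarith : δ < ε) hbad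
    refine ⟨fun u => φ (s + u), r - s, by linarith, ?_, by simpa using hs, by simpa using hr, ?_⟩
    · refine shift_deriv hφ hs0 ?_
      intro u hu
      exact ⟨hu.1, (hI (s + u) ⟨by linarith [hu.1], by linarith [hu.2]⟩).2⟩
    · intro u hu
      have h1 := hin (s + u) ⟨by linarith [hu.1], by linarith [hu.2]⟩
      refine ⟨h1.1, h1.2, (hn T φ hφ hφ0 ?_ ?_ (s + u) (by linarith [hu.1])
        (hI (s + u) ⟨by linarith [hu.1], by linarith [hu.2]⟩).2).le⟩
      · exact lt_of_le_of_lt (infDist_le_infDist_of_subset hMoSub hne)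
          (lt_of_lt_of_le hφδ (min_le_left _ _))
      · apply hR
        have := lt_of_lt_of_le hφδ (min_le_right _ _)
        show infDist (φ 0) Mo ≤ ε
        linarith
  choose g a ha hg hg0 hga hin using key
  let U : Ultrafilter ℕ := hyperfilter ℕ
  have hU : (U : Filter ℕ) ≤ atTop := Nat.hyperfilter_le_atTop
  have hK : ∀ n, ∀ t ∈ Set.Icc 0 (a n), g n t ∈ K := fun n t ht => (hin n t ht).2.1
  obtain ⟨T, -, hT⟩ := isCompact_univ.ultrafilter_le_nhds' (U.map (fun n => (a n : EReal)))
    univ_mem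
  have hT' : Tendsto (fun n => (a n : EReal)) (U : Filter ℕ) (𝓝 T) := hT
  have hab : ∀ n, ε / 2 / C ≤ a n := by
    intro n
    have h1 := sol_lipschitz hC (hg n) (hK n) (s := 0) (t := a n) ⟨le_rfl, ha n⟩ ⟨ha n, le_rfl⟩
    have h2 : infDist (g n (a n)) Mo ≤ infDist (g n 0) Mo + dist (g n (a n)) (g n 0) :=
      infDist_le_infDist_add_dist
    rw [hg0, hga, dist_eq_norm] at h2
    rw [sub_zero, abs_of_nonneg (ha n)] at h1
    rw [div_le_iff₀ hCpos]
    linarith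
  have hTpos : 0 < T := by
    have : ((ε / 2 / C : ℝ) : EReal) ≤ T :=
      ge_of_tendsto hT' (Eventually.of_forall fun n => EReal.coe_le_coe_iff.2 (hab n))
    refine lt_of_lt_of_le ?_ this
    exact_mod_cast (by positivity : 0 < ε / 2 / C)
  have hTa : ∀ t : ℝ, (t : EReal) < T → ∀ᶠ n in (U : Filter ℕ), t < a n := by
    intro t ht
    filter_upwards [hT'.eventually (lt_mem_nhds ht)] with n hn
    exact_mod_cast hn
  obtain ⟨ψ, hψ, hlim⟩ := limit_solution hf hKc U g a hg hK hTpos hTa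
  have h0 := hlim 0 le_rfl hTpos
  have hMi0 : ψ 0 ∈ Mi := by
    rw [hMiClosed.mem_iff_infDist_zero (hne.mono hMoSub)]
    refine le_antisymm ?_ infDist_nonneg
    refine le_of_tendsto_of_tendsto (tendsto_infDist Mi h0)
      (tendsto_one_div_add_atTop_nhds_zero_nat.mono_left hU) (Eventually.of_forall fun n => ?_)
    exact (hin n 0 ⟨le_rfl, ha n⟩).2.2
  have hψ0 : infDist (ψ 0) Mo = δ := by
    have := tendsto_infDist Mo h0
    simp only [hg0] at this
    exact tendsto_nhds_unique this tendsto_const_nhds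
  have hsmall := hstab T ψ hψ hMi0 (by linarith)
    (hR _ (show infDist (ψ 0) Mo ≤ ε by linarith))
  induction T with
  | bot => simp at hTpos
  | top =>
    have htend := hMoAttr ψ hψ hMi0
    have : ∀ t : ℝ, 0 ≤ t → δ ≤ infDist (ψ t) Mo := by
      intro t ht
      refine ge_of_tendsto (tendsto_infDist Mo (hlim t ht (EReal.coe_lt_top t))) ?_
      filter_upwards [hTa t (EReal.coe_lt_top t)] with n hn
      exact (hin n t ⟨ht, hn.le⟩).1
    have h2 : δ ≤ 0 := ge_of_tendsto htend (by
      filter_upwards [eventually_ge_atTop 0] with t ht using this t ht)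
    linarith
  | coe τ =>
    have hτ : 0 < τ := by exact_mod_cast hTpos
    set e := ε / (8 * C) with he
    have hepos : 0 < e := by positivity
    have heC : C * e = ε / 8 := by rw [he]; field_simp
    set t := max 0 (τ - e)
    have ht0 : 0 ≤ t := le_max_left _ _
    have ht1 : τ - e ≤ t := le_max_right _ _
    have htτ : t < τ := max_lt hτ (by linarith)
    have htT : (t : EReal) < (τ : EReal) := by exact_mod_cast htτ
    have hlt := hsmall t ht0 htT
    have hup : ∀ᶠ n in (U : Filter ℕ), a n < τ + e := by
      have : (τ : EReal) < ((τ + e : ℝ) : EReal) := by exact_mod_cast (by linarith : τ < τ + e)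
      filter_upwards [hT'.eventually (gt_mem_nhds this)] with n hn
      exact_mod_cast hn
    have hge : 3 * ε / 4 ≤ infDist (ψ t) Mo := by
      refine ge_of_tendsto (tendsto_infDist Mo (hlim t ht0 htT)) ?_
      filter_upwards [hTa t htT, hup] with n hn1 hn2
      have h1 := sol_lipschitz hC (hg n) (hK n) (s := t) (t := a n) ⟨ht0, hn1.le⟩ ⟨ha n, le_rfl⟩
      have h2 : infDist (g n (a n)) Mo ≤ infDist (g n t) Mo + dist (g n (a n)) (g n t) :=
        infDist_le_infDist_add_dist
      rw [hga, dist_eq_norm] at h2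
      rw [abs_of_nonneg (by linarith)] at h1
      have h3 : C * (a n - t) ≤ C * (2 * e) := by
        apply mul_le_mul_of_nonneg_left _ hCpos.le
        linarith
      linarith
    linarith

end Helpers

theorem hierarchical_asymptotic_stability_ct {d : ℕ}
    (f : EuclideanSpace ℝ (Fin d) → EuclideanSpace ℝ (Fin d)) (hf : Continuous f)
    (Me Mi Mo : Set (EuclideanSpace ℝ (Fin d)))
    (hMeClosed : IsClosed Me) (hMeInv : FwdInvariant f Me)
    (hMiSub : Mi ⊆ Me) (hMiClosed : IsClosed Mi)
    (hMiStable : StableRelCT f Me Mi) (hMiAttr : GloballyAttractiveRelCT f Me Mi)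
    (hMoSub : Mo ⊆ Mi) (hMoCompact : IsCompact Mo)
    (hMoStable : StableRelCT f Mi Mo) (hMoAttr : GloballyAttractiveRelCT f Mi Mo) :
    StableRelCT f Me Mo ∧
      ∃ δ > (0 : ℝ), ∀ φ : ℝ → EuclideanSpace ℝ (Fin d), IsSolution f ⊤ φ →
        φ 0 ∈ Me → infDist (φ 0) Mo < δ →
          Tendsto (fun t : ℝ => infDist (φ t) Mo) atTop (𝓝 0) := by
  rcases Mo.eq_empty_or_nonempty with hemp | hne
  · subst hemp
    refine ⟨fun ε hε Δ hΔ => ⟨1, one_pos, ?_⟩, 1, one_pos, ?_⟩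
    · intro T φ _ _ _ _ t _ _
      simpa using hε
    · intro φ _ _ _
      simp
  have hst := stable_part f hf Me Mi Mo hMiClosed hMiStable hMoSub hMoCompact hne hMoStable hMoAttr
  refine ⟨?_, ?_⟩
  · intro ε hε Δ _
    obtain ⟨δ, hδ, h⟩ := hst ε hε
    exact ⟨δ, hδ, fun T φ h1 h2 h3 _ => h T φ h1 h2 h3⟩
  obtain ⟨δ, hδ, hδs⟩ := hst 1 one_pos
  refine ⟨δ, hδ, ?_⟩
  intro φ hφ hφ0 hφδ
  have hbd := hδs ⊤ φ hφ hφ0 hφδ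
  have hKc := sublevel_compact hMoCompact hne 1
  -- the trajectory comes arbitrarily close to `Mo`
  have hclose : ∀ η > (0 : ℝ), ∃ t : ℝ, 0 ≤ t ∧ infDist (φ t) Mo < η := by
    intro η hη
    by_contra! hfar
    let U : Ultrafilter ℕ := hyperfilter ℕ
    have hU : (U : Filter ℕ) ≤ atTop := Nat.hyperfilter_le_atTop
    have hTa : ∀ t : ℝ, (t : EReal) < ⊤ → ∀ᶠ n : ℕ in (U : Filter ℕ), t < (n : ℝ) := by
      intro t _
      exact hU (tendsto_natCast_atTop_atTop.eventually (eventually_gt_atTop t))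
    obtain ⟨ψ, hψ, hlim⟩ := limit_solution hf hKc U (fun n u => φ ((n : ℝ) + u)) (fun n => (n : ℝ))
      (fun n => shift_deriv hφ n.cast_nonneg (fun u hu => ⟨hu.1, EReal.coe_lt_top _⟩))
      (fun n t ht => (hbd ((n : ℝ) + t) (add_nonneg n.cast_nonneg ht.1) (EReal.coe_lt_top _)).le)
      (EReal.coe_lt_top 0) hTa
    have hMi0 : ψ 0 ∈ Mi := by
      rw [hMiClosed.mem_iff_infDist_zero (hne.mono hMoSub)]
      have h1 := tendsto_infDist Mi (hlim 0 le_rfl (EReal.coe_lt_top 0))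
      have h2 := (hMiAttr φ hφ hφ0).comp (tendsto_natCast_atTop_atTop.mono_left hU)
      refine tendsto_nhds_unique h1 ?_
      simpa [Function.comp_def] using h2
    have h3 : η ≤ 0 := by
      refine ge_of_tendsto (hMoAttr ψ hψ hMi0) ?_
      filter_upwards [eventually_ge_atTop 0] with t ht
      refine ge_of_tendsto (tendsto_infDist Mo (hlim t ht (EReal.coe_lt_top t))) ?_
      exact Eventually.of_forall fun n => hfar _ (add_nonneg n.cast_nonneg ht)
    linarith
  rw [Metric.tendsto_atTop]
  intro ε hε
  obtain ⟨η, hη, h⟩ := hst ε hε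
  obtain ⟨s, hs, hsη⟩ := hclose η hη
  refine ⟨s, fun t ht => ?_⟩
  have := h ⊤ _ (shift_complete hφ hs)
    (by simpa using hMeInv ⊤ φ hφ hφ0 s hs (EReal.coe_lt_top s)) (by simpa using hsη)
    (t - s) (by linarith) (EReal.coe_lt_top _)
  rw [Real.dist_eq, sub_zero, abs_of_nonneg infDist_nonneg]
  simpa using this
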